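/- For every t ≥ 0, the composed map Υ^{-1} ∘ θ_t ∘ Υ maps 𝒟 into 𝒟; that is, if ψ ∈ 𝒟 then Υ^{-1}(θ_t(Υ(ψ))) ∈ 𝒟. -/

import Mathlib

open Set Filter

noncomputable section

/-- `f ∈ 𝒞`: continuous, non-decreasing, `ℝ₊`-valued on `ℝ₊`, with `f 0 = 0`. -/
def memC (f : ℝ → ℝ) : Prop :=
  ContinuousOn f (Ici 0) ∧ MonotoneOn f (Ici 0) ∧ f 0 = 0 ∧ ∀ u ∈ Ici (0:ℝ), 0 ≤ f u

/-- `f ∈ 𝒞^↑`: member of `𝒞` that is strictly increasing and tends to `∞` at `∞`. -/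
def memCup (f : ℝ → ℝ) : Prop :=
  memC f ∧ StrictMonoOn f (Ici 0) ∧ Tendsto f atTop atTop

/-- the soliton size associated with the index `i : Fin I`, namely `i+1`, as a real number. -/
def sz {I : ℕ} (i : Fin I) : ℝ := (i : ℕ) + 1

/-- the effective-distance (integrated slot density) function `φ_i`. -/
def phi {I : ℕ} (ψ : Fin I → ℝ → ℝ) (i : Fin I) (u : ℝ) : ℝ :=
  u - ∑ j, 2 * min (sz i) (sz j) * ψ j u

/-- the top effective-distance function `φ_I` (note `min (I, j) = j` for `j ≤ I`). -/
def phiTop {I : ℕ} (ψ : Fin I → ℝ → ℝ) (u : ℝ) : ℝ :=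
  u - ∑ j, 2 * sz j * ψ j u

/-- `ψ ∈ 𝓕`. -/
def memF {I : ℕ} (ψ : Fin I → ℝ → ℝ) : Prop :=
  (∀ i, memC (ψ i)) ∧ memCup (phiTop ψ)

/-- the inverse of `f : ℝ₊ → ℝ₊` (as a function `ℝ → ℝ` supported in domain `Ici 0`). -/
def rinv (f : ℝ → ℝ) : ℝ → ℝ := Function.invFunOn f (Ici 0)

/-- the effective scaling (scattering) map `Υ`. -/
def Upsilon {I : ℕ} (ψ : Fin I → ℝ → ℝ) : Fin I → ℝ → ℝ :=
  fun i => ψ i ∘ rinv (phi ψ i)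

/-- `gammaK ψb k = γ_{I-k}`, defined by downward recursion from `γ_I = id`:
`γ_i(z) = z + ∑_{j>i} 2(j-i) ψb_j (γ_j z)`. -/
def gammaK {I : ℕ} (ψb : Fin I → ℝ → ℝ) : ℕ → ℝ → ℝ
  | 0 => fun z => z
  | k + 1 => fun z =>
      z + ∑ m ∈ (Finset.range (k + 1)).attach,
        2 * (((k + 1 : ℕ) : ℝ) - ((m : ℕ) : ℝ)) *
          (if h : (m : ℕ) < I then
              ψb ⟨I - 1 - (m : ℕ), by omega⟩ (gammaK ψb (m : ℕ) z)
            else 0)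
  termination_by k => k
  decreasing_by have hm := Finset.mem_range.mp m.2; omega

/-- `γ_i`, for `i = 0, 1, …, I`. -/
def gam {I : ℕ} (ψb : Fin I → ℝ → ℝ) (i : ℕ) : ℝ → ℝ := gammaK ψb (I - i)

/-- the spatial reconstruction (inverse scattering) map `Γ`. -/
def Gamma {I : ℕ} (ψb : Fin I → ℝ → ℝ) : Fin I → ℝ → ℝ :=
  fun i => ψb i ∘ gam ψb ((i : ℕ) + 1) ∘ rinv (gam ψb 0)

/-- the free-evolution shift `θ_t`. -/
def theta {I : ℕ} (t : ℝ) (ψb : Fin I → ℝ → ℝ) : Fin I → ℝ → ℝ :=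
  fun i z => ψb i (max (z - sz i * t) 0)

/-- `ψ ∈ 𝒟`: member of `𝓕` satisfying the density condition
`∑_i i · sup_{u₁≠u₂} (ψ_i(u₁)-ψ_i(u₂))/(φ_i(u₁)-φ_i(u₂)) < 1/2`. -/
def memD {I : ℕ} (ψ : Fin I → ℝ → ℝ) : Prop :=
  memF ψ ∧
  ∃ c : Fin I → ℝ,
    (∀ i, ∀ u₁ ∈ Ici (0:ℝ), ∀ u₂ ∈ Ici (0:ℝ), u₂ < u₁ →
      ψ i u₁ - ψ i u₂ ≤ c i * (phi ψ i u₁ - phi ψ i u₂)) ∧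
    ∑ i, sz i * c i < 1 / 2

/-- `ψb ∈ 𝒟̄`: member of `𝒞^I` satisfying the density condition
`∑_i i · sup_{z₁≠z₂} (ψb_i(z₁)-ψb_i(z₂))/(z₁-z₂) < 1/2`. -/
def memDbar {I : ℕ} (ψb : Fin I → ℝ → ℝ) : Prop :=
  (∀ i, memC (ψb i)) ∧
  ∃ c : Fin I → ℝ,
    (∀ i, ∀ z₁ ∈ Ici (0:ℝ), ∀ z₂ ∈ Ici (0:ℝ), z₂ < z₁ →
      ψb i z₁ - ψb i z₂ ≤ c i * (z₁ - z₂)) ∧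
    ∑ i, sz i * c i < 1 / 2

/-- the extension `f^ℝ` of `f` to `ℝ`, by `0` on the negative half-line. -/
def extZ (f : ℝ → ℝ) : ℝ → ℝ := fun u => if 0 ≤ u then f u else 0

/-- the extension `f^{ℝ,↑}` of `f` to `ℝ`, by the identity on the negative half-line. -/
def extId (f : ℝ → ℝ) : ℝ → ℝ := fun u => if 0 ≤ u then f u else u

/-- `f ∈ 𝒞^q`. -/
def memCq (q : ℕ) (f : ℝ → ℝ) : Prop := memC f ∧ ContDiff ℝ q (extZ f)

/-- `f ∈ 𝒞^{↑,q}`. -/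
def memCupq (q : ℕ) (f : ℝ → ℝ) : Prop := memCup f ∧ ContDiff ℝ q (extId f)

/-- `f ∈ C^q(ℝ₊², ℝ₊)`: `ℝ₊`-valued and `q`-times continuously differentiable on the
quadrant (one-sided at the boundary). -/
def memCqTwo (q : ℕ) (f : ℝ → ℝ → ℝ) : Prop :=
  (∀ u ∈ Ici (0:ℝ), ∀ t ∈ Ici (0:ℝ), 0 ≤ f u t) ∧
  ContDiffOn ℝ q (fun p : ℝ × ℝ => f p.1 p.2) (Ici 0 ×ˢ Ici 0)

/-- the matrix `M(ρ)`. -/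
def Mmat {I : ℕ} (ρ : Fin I → ℝ) : Matrix (Fin I) (Fin I) ℝ :=
  Matrix.of fun i j =>
    if i = j then 1 - ∑ k ∈ Finset.univ.erase i, 2 * min (sz i) (sz k) * ρ k
    else 2 * min (sz i) (sz j) * ρ j

/-- the effective speeds `v^eff(ρ) = M(ρ)⁻¹ v`, where `v_i = i`. -/
def veff {I : ℕ} (ρ : Fin I → ℝ) : Fin I → ℝ :=
  ((Mmat ρ)⁻¹).mulVec fun i => sz i

/-- `ρ ∈ 𝒟_density`. -/
def memDdensity {I : ℕ} (ρ : Fin I → ℝ → ℝ) : Prop :=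
  (∀ i, (∀ u ∈ Ici (0:ℝ), 0 ≤ ρ i u) ∧ ContDiff ℝ 1 (extZ (ρ i))) ∧
  (∀ u ∈ Ici (0:ℝ), ∑ i, 2 * sz i * ρ i u < 1) ∧
  ∃ c : Fin I → ℝ,
    (∀ i, ∀ u ∈ Ici (0:ℝ),
      ρ i u ≤ c i * (1 - ∑ j, 2 * min (sz i) (sz j) * ρ j u)) ∧
    ∑ i, sz i * c i < 1 / 2

theorem memC.congr {f g : ℝ → ℝ} (hf : memC f) (h : ∀ u ∈ Ici (0:ℝ), g u = f u) : memC g :=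
  ⟨hf.1.congr h, hf.2.1.congr fun u hu => (h u hu).symm,
    (h 0 self_mem_Ici).trans hf.2.2.1, fun u hu => (h u hu).symm ▸ hf.2.2.2 u hu⟩

theorem memC.comp {f g : ℝ → ℝ} (hf : memC f) (hg : memC g) : memC (f ∘ g) :=
  ⟨hf.1.comp hg.1 hg.2.2.2,
    fun _ ha _ hb hab => hf.2.1 (hg.2.2.2 _ ha) (hg.2.2.2 _ hb) (hg.2.1 ha hb hab),
    by simp [hg.2.2.1, hf.2.2.1], fun u hu => hf.2.2.2 _ (hg.2.2.2 u hu)⟩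

theorem memC.const_mul {f : ℝ → ℝ} (hf : memC f) {a : ℝ} (ha : 0 ≤ a) :
    memC fun u => a * f u :=
  ⟨continuousOn_const.mul hf.1,
    fun _ hx _ hy hxy => mul_le_mul_of_nonneg_left (hf.2.1 hx hy hxy) ha,
    by simp [hf.2.2.1], fun u hu => mul_nonneg ha (hf.2.2.2 u hu)⟩

theorem memC.sum {ι : Type*} {s : Finset ι} {f : ι → ℝ → ℝ} (hf : ∀ i ∈ s, memC (f i)) :
    memC fun u => ∑ i ∈ s, f i u :=
  ⟨continuousOn_finsetSum s fun i hi => (hf i hi).1,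
    fun _ hx _ hy hxy => Finset.sum_le_sum fun i hi => (hf i hi).2.1 hx hy hxy,
    Finset.sum_eq_zero fun i hi => (hf i hi).2.2.1,
    fun u hu => Finset.sum_nonneg fun i hi => (hf i hi).2.2.2 u hu⟩

theorem memCup.add {f g : ℝ → ℝ} (hf : memCup f) (hg : memC g) :
    memCup fun u => f u + g u := by
  refine ⟨⟨hf.1.1.add hg.1, hf.1.2.1.add hg.2.1, by simp [hf.1.2.2.1, hg.2.2.1],
    fun u hu => add_nonneg (hf.1.2.2.2 u hu) (hg.2.2.2 u hu)⟩,
    fun x hx y hy hxy => add_lt_add_of_lt_of_le (hf.2.1 hx hy hxy) (hg.2.1 hx hy hxy.le), ?_⟩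
  refine tendsto_atTop_mono' _ ?_ hf.2.2
  filter_upwards [eventually_ge_atTop 0] with u hu
  linarith [hg.2.2.2 u hu]

theorem memCup_id : memCup fun u => u :=
  ⟨⟨continuousOn_id, monotoneOn_id, rfl, fun _ hu => hu⟩, strictMonoOn_id, tendsto_id⟩

theorem memCup.congr {f g : ℝ → ℝ} (hf : memCup f) (h : ∀ u ∈ Ici (0:ℝ), g u = f u) :
    memCup g :=
  ⟨hf.1.congr h, hf.2.1.congr fun u hu => (h u hu).symm,
    hf.2.2.congr' <| (eventually_ge_atTop 0).mono fun u hu => (h u hu).symm⟩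

theorem memCup.surjOn {f : ℝ → ℝ} (hf : memCup f) : SurjOn f (Ici 0) (Ici 0) := by
  intro z hz
  obtain ⟨b, hb, hb0⟩ := ((hf.2.2.eventually_ge_atTop z).and (eventually_ge_atTop 0)).exists
  obtain ⟨u, hu, rfl⟩ := intermediate_value_Icc hb0 (hf.1.1.mono Icc_subset_Ici_self)
    ⟨hf.1.2.2.1.trans_le hz, hb⟩
  exact ⟨u, hu.1, rfl⟩

theorem memCup.rinv_mem {f : ℝ → ℝ} (hf : memCup f) {z : ℝ} (hz : 0 ≤ z) : 0 ≤ rinv f z :=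
  Function.invFunOn_mem (hf.surjOn hz)

theorem memCup.apply_rinv {f : ℝ → ℝ} (hf : memCup f) {z : ℝ} (hz : 0 ≤ z) :
    f (rinv f z) = z :=
  Function.invFunOn_eq (hf.surjOn hz)

theorem memCup.rinv_apply {f : ℝ → ℝ} (hf : memCup f) {u : ℝ} (hu : 0 ≤ u) :
    rinv f (f u) = u :=
  hf.2.1.injOn (hf.rinv_mem (hf.1.2.2.2 u hu)) hu (hf.apply_rinv (hf.1.2.2.2 u hu))

theorem memCup.strictMonoOn_rinv {f : ℝ → ℝ} (hf : memCup f) : StrictMonoOn (rinv f) (Ici 0) := by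
  intro x hx y hy hxy
  rw [← hf.2.1.lt_iff_lt (hf.rinv_mem hx) (hf.rinv_mem hy), hf.apply_rinv hx, hf.apply_rinv hy]
  exact hxy

theorem memCup.continuousOn_rinv {f : ℝ → ℝ} (hf : memCup f) : ContinuousOn (rinv f) (Ici 0) := by
  have hmono : Monotone (extId (rinv f)) := by
    intro x y hxy
    unfold extId
    split_ifs with hx hy hy
    · exact hf.strictMonoOn_rinv.monotoneOn hx hy hxy
    · linarith
    · linarith [hf.rinv_mem hy]
    · exact hxy
  have hsurj : Function.Surjective (extId (rinv f)) := by
    intro u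
    by_cases hu : 0 ≤ u
    · exact ⟨f u, by rw [extId, if_pos (hf.1.2.2.2 u hu), hf.rinv_apply hu]⟩
    · exact ⟨u, by rw [extId, if_neg hu]⟩
  exact (hmono.continuous_of_surjective hsurj).continuousOn.congr
    fun z hz => (if_pos (mem_Ici.mp hz)).symm

theorem memCup.rinv {f : ℝ → ℝ} (hf : memCup f) : memCup (rinv f) := by
  refine ⟨⟨hf.continuousOn_rinv, hf.strictMonoOn_rinv.monotoneOn, ?_, fun z => hf.rinv_mem⟩,
    hf.strictMonoOn_rinv, tendsto_atTop.2 fun b => ?_⟩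
  · simpa [hf.1.2.2.1] using hf.rinv_apply le_rfl
  · have hb : (0:ℝ) ≤ max b 0 := le_max_right _ _
    filter_upwards [eventually_ge_atTop (f (max b 0))] with z hz
    have h0 := hf.1.2.2.2 _ hb
    calc b ≤ max b 0 := le_max_left _ _
      _ = _root_.rinv f (f (max b 0)) := (hf.rinv_apply hb).symm
      _ ≤ _root_.rinv f z := hf.strictMonoOn_rinv.monotoneOn h0 (h0.trans hz) hz

theorem sz_nonneg {I : ℕ} (i : Fin I) : 0 ≤ sz i := by unfold sz; positivity

theorem memCup_phi {I : ℕ} {ψ : Fin I → ℝ → ℝ} (hψ : memF ψ) (i : Fin I) :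
    memCup (phi ψ i) := by
  have h : memC fun u => ∑ j, 2 * (sz j - min (sz i) (sz j)) * ψ j u :=
    memC.sum fun j _ => (hψ.1 j).const_mul <|
      mul_nonneg zero_le_two (sub_nonneg.2 (min_le_right _ _))
  refine (hψ.2.add h).congr fun u _ => ?_
  simp only [phi, phiTop]
  rw [sub_add, ← Finset.sum_sub_distrib]
  congr 1
  exact Finset.sum_congr rfl fun j _ => by ring

/-- The scattering map sends `𝒟` into `𝒟̄`. -/
theorem memDbar_Upsilon {I : ℕ} {ψ : Fin I → ℝ → ℝ} (hψ : memD ψ) : memDbar (Upsilon ψ) := by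
  obtain ⟨hF, c, hc, hsum⟩ := hψ
  have hφ := memCup_phi hF
  refine ⟨fun i => (hF.1 i).comp (hφ i).rinv.1, c, fun i z₁ h₁ z₂ h₂ hlt => ?_, hsum⟩
  have := hc i _ ((hφ i).rinv_mem h₁) _ ((hφ i).rinv_mem h₂)
    ((hφ i).strictMonoOn_rinv h₂ h₁ hlt)
  rwa [(hφ i).apply_rinv h₁, (hφ i).apply_rinv h₂] at this

/-- The free evolution preserves `𝒟̄`. -/
theorem memDbar.theta {I : ℕ} {ψb : Fin I → ℝ → ℝ} (hψ : memDbar ψb) {t : ℝ} (ht : 0 ≤ t) :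
    memDbar (theta t ψb) := by
  obtain ⟨hC, c, hc, hsum⟩ := hψ
  refine ⟨fun i => ?_, c, fun i z₁ h₁ z₂ h₂ hlt => ?_, hsum⟩
  · have hshift : memC fun z => max (z - sz i * t) 0 :=
      ⟨by fun_prop, fun x _ y _ hxy => max_le_max (by linarith) le_rfl,
        max_eq_right (by linarith [mul_nonneg (sz_nonneg i) ht]), fun _ _ => le_max_right _ _⟩
    exact (hC i).comp hshift
  · have hc0 : 0 ≤ c i := by
      have h := hc i 1 (mem_Ici.2 zero_le_one) 0 self_mem_Ici one_pos
      have h' := (hC i).2.2.2 1 (mem_Ici.2 zero_le_one)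
      rw [(hC i).2.2.1] at h
      linarith
    have hle : max (z₂ - sz i * t) 0 ≤ max (z₁ - sz i * t) 0 := max_le_max (by linarith) le_rfl
    have hgap : max (z₁ - sz i * t) 0 - max (z₂ - sz i * t) 0 ≤ z₁ - z₂ := by
      rw [sub_le_iff_le_add]
      exact max_le (by linarith [le_max_left (z₂ - sz i * t) 0])
        (by linarith [le_max_right (z₂ - sz i * t) 0])
    refine le_trans ?_ (mul_le_mul_of_nonneg_left hgap hc0)
    rcases hle.eq_or_lt with heq | h
    · simp [_root_.theta, heq]
    · exact hc i _ (mem_Ici.2 (le_max_right _ _)) _ (mem_Ici.2 (le_max_right _ _)) h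

theorem memCup_gammaK {I : ℕ} {ψb : Fin I → ℝ → ℝ} (hψ : ∀ i, memC (ψb i)) (k : ℕ) :
    memCup (gammaK ψb k) := by
  induction k using Nat.strong_induction_on with
  | _ k ih =>
    cases k with
    | zero => rw [gammaK]; exact memCup_id
    | succ k =>
      rw [gammaK]
      refine memCup_id.add (memC.sum fun m _ => ?_)
      have hm := Finset.mem_range.mp m.2
      have hcoef : (0:ℝ) ≤ 2 * (((k + 1 : ℕ) : ℝ) - ((m : ℕ) : ℝ)) :=
        mul_nonneg zero_le_two (sub_nonneg.2 (Nat.cast_le.2 hm.le))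
      by_cases h : (m : ℕ) < I
      · simp only [h, dif_pos]
        exact ((hψ _).comp (ih m hm).1).const_mul hcoef
      · simp only [h, dif_neg, not_false_eq_true, mul_zero]
        exact ⟨continuousOn_const, monotoneOn_const, rfl, fun _ _ => le_rfl⟩

theorem memCup_gam {I : ℕ} {ψb : Fin I → ℝ → ℝ} (hψ : ∀ i, memC (ψb i)) (i : ℕ) :
    memCup (gam ψb i) :=
  memCup_gammaK hψ _

theorem gam_eq {I : ℕ} (ψb : Fin I → ℝ → ℝ) {i : ℕ} (hi : i ≤ I) (z : ℝ) :
    gam ψb i z =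
      z + ∑ j, 2 * (sz j - min (i : ℝ) (sz j)) * ψb j (gam ψb ((j : ℕ) + 1) z) := by
  obtain ⟨k, rfl⟩ := Nat.exists_eq_add_of_le hi
  have hk : i + k - i = k := by omega
  rw [gam, hk]
  cases k with
  | zero =>
    rw [gammaK, eq_comm, add_eq_left]
    refine Finset.sum_eq_zero fun j _ => ?_
    have : sz j ≤ (i : ℝ) := by unfold sz; exact_mod_cast j.2
    simp [min_eq_right this]
  | succ k =>
    rw [gammaK]
    beta_reduce
    congr 1
    rw [Finset.sum_attach (Finset.range (k + 1)) fun m =>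
      2 * (((k + 1 : ℕ) : ℝ) - (m : ℝ)) *
        (if h : m < i + (k + 1) then
          ψb ⟨i + (k + 1) - 1 - m, by omega⟩ (gammaK ψb m z) else 0)]
    have hsub : Finset.range (k + 1) ⊆ Finset.range (i + (k + 1)) :=
      Finset.range_subset_range.2 (by omega)
    rw [← Equiv.sum_comp Fin.revPerm]
    trans ∑ m ∈ Finset.range (i + (k + 1)), 2 * max (((k + 1 : ℕ) : ℝ) - (m : ℝ)) 0 *
        (if h : m < i + (k + 1) then
          ψb ⟨i + (k + 1) - 1 - m, by omega⟩ (gammaK ψb m z) else 0)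
    · rw [← Finset.sum_subset hsub]
      · refine Finset.sum_congr rfl fun m hm => ?_
        rw [max_eq_left]
        exact sub_nonneg.2 (Nat.cast_le.2 (Finset.mem_range.1 hm).le)
      · intro m _ hm
        rw [Finset.mem_range, not_lt] at hm
        rw [max_eq_right (sub_nonpos.2 (Nat.cast_le.2 hm)), mul_zero, zero_mul]
    · rw [Finset.sum_range]
      refine Finset.sum_congr rfl fun m _ => ?_
      have hm := m.2
      have hrev : (⟨i + (k + 1) - 1 - (m : ℕ), by omega⟩ : Fin (i + (k + 1))) = m.rev := by
        ext; simp only [Fin.val_rev]; omega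
      have hidx : i + (k + 1) - ((m.rev : ℕ) + 1) = m := by
        rw [Fin.val_rev]; omega
      have hsz : sz m.rev = (i : ℝ) + (((k + 1 : ℕ) : ℝ) - (m : ℕ)) := by
        have : (m.rev : ℕ) + 1 + m = i + (k + 1) := by rw [Fin.val_rev]; omega
        have : ((m.rev : ℕ) : ℝ) + 1 + (m : ℕ) = i + ((k + 1 : ℕ) : ℝ) := by exact_mod_cast this
        unfold sz
        linarith
      rw [dif_pos hm, hrev, Fin.revPerm_apply, gam, hidx, hsz]
      congr 2
      rcases le_total (((k + 1 : ℕ) : ℝ) - (m : ℕ)) 0 with h | h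
      · rw [max_eq_right h, min_eq_right (by linarith)]; ring
      · rw [max_eq_left h, min_eq_left (by linarith)]; ring

theorem gam_zero_eq {I : ℕ} (ψb : Fin I → ℝ → ℝ) (z : ℝ) :
    gam ψb 0 z = z + ∑ j, 2 * sz j * ψb j (gam ψb ((j : ℕ) + 1) z) := by
  rw [gam_eq ψb (Nat.zero_le I)]
  congr 1
  refine Finset.sum_congr rfl fun j _ => ?_
  rw [Nat.cast_zero, min_eq_left (sz_nonneg j), sub_zero]

theorem phiTop_Gamma {I : ℕ} {ψb : Fin I → ℝ → ℝ} (hψ : ∀ i, memC (ψb i)) {u : ℝ} (hu : 0 ≤ u) :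
    phiTop (Gamma ψb) u = rinv (gam ψb 0) u := by
  have h := gam_zero_eq ψb (rinv (gam ψb 0) u)
  rw [(memCup_gam hψ 0).apply_rinv hu] at h
  simp only [phiTop, Gamma, Function.comp_apply]
  linarith

theorem phi_Gamma {I : ℕ} {ψb : Fin I → ℝ → ℝ} (hψ : ∀ i, memC (ψb i)) (i : Fin I) {u : ℝ}
    (hu : 0 ≤ u) : phi (Gamma ψb) i u = gam ψb ((i : ℕ) + 1) (rinv (gam ψb 0) u) := by
  have hi : (((i : ℕ) + 1 : ℕ) : ℝ) = sz i := by simp [sz]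
  rw [gam_eq ψb (Nat.succ_le_of_lt i.2), hi, ← phiTop_Gamma hψ hu]
  simp only [phi, phiTop]
  rw [sub_add, ← phiTop.eq_1 (Gamma ψb) u, phiTop_Gamma hψ hu, ← Finset.sum_sub_distrib]
  congr 1
  refine Finset.sum_congr rfl fun j _ => ?_
  simp only [Gamma, Function.comp_apply]
  ring

/-- The reconstruction map sends `𝒟̄` into `𝒟`. -/
theorem memD_Gamma {I : ℕ} {ψb : Fin I → ℝ → ℝ} (hψ : memDbar ψb) : memD (Gamma ψb) := by
  obtain ⟨hC, c, hc, hsum⟩ := hψ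
  have hg := memCup_gam hC
  have hφ (i : Fin I) : StrictMonoOn (fun u => gam ψb ((i : ℕ) + 1) (rinv (gam ψb 0) u)) (Ici 0) :=
    fun u₂ h₂ u₁ h₁ hlt => (hg _).2.1 ((hg 0).rinv_mem h₂) ((hg 0).rinv_mem h₁)
      ((hg 0).strictMonoOn_rinv h₂ h₁ hlt)
  refine ⟨⟨fun i => (hC i).comp ((hg _).1.comp (hg 0).rinv.1),
    (hg 0).rinv.congr fun u => phiTop_Gamma hC⟩, c, fun i u₁ h₁ u₂ h₂ hlt => ?_, hsum⟩
  rw [phi_Gamma hC i h₁, phi_Gamma hC i h₂]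
  exact hc i _ ((hg _).1.2.2.2 _ ((hg 0).rinv_mem h₁)) _ ((hg _).1.2.2.2 _ ((hg 0).rinv_mem h₂))
    (hφ i h₂ h₁ hlt)

/-- for `t ≥ 0`, the map `Υ⁻¹ ∘ θ_t ∘ Υ` maps `𝒟` into `𝒟`
(here `Υ⁻¹ = Γ`, the spatial reconstruction map). -/
theorem stmt_8 {I : ℕ} (hI : 1 ≤ I) (t : ℝ) (ht : 0 ≤ t) (ψ : Fin I → ℝ → ℝ)
    (hψ : memD ψ) :
    memD (Gamma (theta t (Upsilon ψ))) := by
  exact memD_Gamma ((memDbar_Upsilon hψ).theta ht)
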